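/- arXiv:2012.08445 — 5 statements merged into one kernel-verified Lean document; each statement's English description precedes it below -/
import Mathlib

section
/- Let d ≥ 1 and let σ1, σ2, σ3 be permutations of Fin d. For i ∈ {1,…,d}, define |ĩ⟩ = d^{-1/2} ∑_{s ∈ Fin d} |σ1^i(s)⟩⊗|σ2^i(s)⟩⊗|σ3^i(s)⟩ ∈ (ℂ^d)^{⊗3}, and let ρ̃ = (1/d) ∑_{i=1}^d |ĩ⟩⟨ĩ|. Then I₃(P1:P2:P3)(ρ̃) = −2 log d if and only if for all distinct a, b ∈ {1,2,3}, all s ∈ Fin d and all i ∈ {1,…,d−1}, one has σ_a^i(s) ≠ σ_b^i(s). -/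
open Matrix MeasureTheory ProbabilityTheory
open scoped ComplexOrder BigOperators

noncomputable section

/-- von Neumann entropy (natural logarithm), via the eigenvalues of a Hermitian matrix;
`Real.log 0 = 0` implements the convention `0 · log 0 = 0`. -/
def vN {n : Type*} [Fintype n] [DecidableEq n] (ρ : Matrix n n ℂ) : ℝ :=
  if h : ρ.IsHermitian then -∑ k, h.eigenvalues k * Real.log (h.eigenvalues k) else 0

/-- `ρ` is a density matrix: positive semidefinite with unit trace. -/
def IsDensity {n : Type*} [Fintype n] [DecidableEq n] (ρ : Matrix n n ℂ) : Prop :=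
  ρ.PosSemidef ∧ ρ.trace = 1

section reds
variable {α β γ : Type*} [Fintype α] [Fintype β] [Fintype γ]

/-- reduced density on party 1 (partial trace over parties 2, 3) -/
def red1 (ρ : Matrix (α × β × γ) (α × β × γ) ℂ) : Matrix α α ℂ :=
  Matrix.of fun a a' => ∑ b, ∑ c, ρ (a, b, c) (a', b, c)
/-- reduced density on party 2 -/
def red2 (ρ : Matrix (α × β × γ) (α × β × γ) ℂ) : Matrix β β ℂ :=
  Matrix.of fun b b' => ∑ a, ∑ c, ρ (a, b, c) (a, b', c)
/-- reduced density on party 3 -/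
def red3 (ρ : Matrix (α × β × γ) (α × β × γ) ℂ) : Matrix γ γ ℂ :=
  Matrix.of fun c c' => ∑ a, ∑ b, ρ (a, b, c) (a, b, c')
/-- reduced density on parties 1, 2 (partial trace over party 3) -/
def red12 (ρ : Matrix (α × β × γ) (α × β × γ) ℂ) : Matrix (α × β) (α × β) ℂ :=
  Matrix.of fun x y => ∑ c, ρ (x.1, x.2, c) (y.1, y.2, c)
/-- reduced density on parties 1, 3 -/
def red13 (ρ : Matrix (α × β × γ) (α × β × γ) ℂ) : Matrix (α × γ) (α × γ) ℂ :=
  Matrix.of fun x y => ∑ b, ρ (x.1, b, x.2) (y.1, b, y.2)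
/-- reduced density on parties 2, 3 -/
def red23 (ρ : Matrix (α × β × γ) (α × β × γ) ℂ) : Matrix (β × γ) (β × γ) ℂ :=
  Matrix.of fun x y => ∑ a, ρ (a, x.1, x.2) (a, y.1, y.2)

/-- tripartite information I₃(P1:P2:P3) -/
def I3 [DecidableEq α] [DecidableEq β] [DecidableEq γ]
    (ρ : Matrix (α × β × γ) (α × β × γ) ℂ) : ℝ :=
  vN (red1 ρ) + vN (red2 ρ) + vN (red3 ρ)
    - vN (red12 ρ) - vN (red13 ρ) - vN (red23 ρ) + vN ρ
end reds

/-- rank-one operator |v⟩⟨w| -/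
def outer {X : Type*} (v w : X → ℂ) : Matrix X X ℂ :=
  Matrix.of fun x y => v x * star (w y)

/-- orthonormal family of vectors -/
def ONFam {ι X : Type*} [DecidableEq ι] [Fintype X] (v : ι → X → ℂ) : Prop :=
  ∀ i j, (∑ x, star (v i x) * v j x) = if i = j then (1 : ℂ) else 0

/-- the support (range) of `ρ` is contained in the span of the family `v` -/
def SuppIn {ι X : Type*} [Fintype X] (ρ : Matrix X X ℂ) (v : ι → X → ℂ) : Prop :=
  LinearMap.range ρ.mulVecLin ≤ Submodule.span ℂ (Set.range v)

/-- a (rectangular) matrix is unitary -/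
def IsUnitaryM {A B : Type*} [Fintype A] [Fintype B] [DecidableEq A] [DecidableEq B]
    (U : Matrix A B ℂ) : Prop :=
  U * Uᴴ = 1 ∧ Uᴴ * U = 1

/-- operator norm (largest singular value) of a matrix -/
def opNorm {A B : Type*} [Fintype A] [Fintype B] [DecidableEq B]
    (M : Matrix A B ℂ) : ℝ :=
  ‖LinearMap.toContinuousLinearMap (Matrix.toEuclideanLin M)‖

/-- trace norm: the sum of the singular values -/
def traceNorm {A B : Type*} [Fintype A] [Fintype B] [DecidableEq B]
    (M : Matrix A B ℂ) : ℝ :=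
  ∑ k, Real.sqrt ((Matrix.posSemidef_conjTranspose_mul_self M).1.eigenvalues k)

/-- matrix logarithm taken on the support (eigenvalue `0 ↦ 0`, since `Real.log 0 = 0`) -/
def mlog {n : Type*} [Fintype n] [DecidableEq n] (ρ : Matrix n n ℂ) : Matrix n n ℂ :=
  if h : ρ.IsHermitian then
    (h.eigenvectorUnitary : Matrix n n ℂ) *
      Matrix.diagonal (fun k => (Real.log (h.eigenvalues k) : ℂ)) *
      (h.eigenvectorUnitary : Matrix n n ℂ)ᴴ
  else 0

/-- quantum relative entropy D(ρ‖σ) = Tr(ρ (log ρ − log σ)) -/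
def relEnt {n : Type*} [Fintype n] [DecidableEq n] (ρ σ : Matrix n n ℂ) : ℝ :=
  ((ρ * (mlog ρ - mlog σ)).trace).re

/-- Number of preimages of `y` under `F`. -/
def fiberCard {P Y : Type*} [Fintype P] [DecidableEq Y] (F : P → Y) (y : Y) : ℕ :=
  (Finset.univ.filter fun p => F p = y).card

/-- The sum over the domain of the logarithms of the fibre sizes, i.e. `∑ y, k y * log (k y)`
with `k` the fibre sizes. -/
def fiberLog {P Y : Type*} [Fintype P] [DecidableEq Y] (F : P → Y) : ℝ :=
  ∑ p, Real.log (fiberCard F (F p))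

section fibers
variable {P Y Z : Type*} [Fintype P] [DecidableEq Y] [DecidableEq Z]

lemma fiberCard_pos (F : P → Y) (p : P) : 0 < fiberCard F (F p) :=
  Finset.card_pos.2 ⟨p, by simp⟩

lemma fiberLog_nonneg (F : P → Y) : 0 ≤ fiberLog F :=
  Finset.sum_nonneg fun _ _ => Real.log_natCast_nonneg _

lemma fiberLog_le_comp (F : P → Y) (g : Y → Z) : fiberLog F ≤ fiberLog (g ∘ F) := by
  refine Finset.sum_le_sum fun p _ => Real.log_le_log (by exact_mod_cast fiberCard_pos F p) ?_
  refine Nat.cast_le.2 (Finset.card_le_card fun q hq => ?_)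
  simp only [Finset.mem_filter, Finset.mem_univ, true_and] at hq
  simp [hq]

lemma fiberLog_eq_zero_iff (F : P → Y) : fiberLog F = 0 ↔ Function.Injective F := by
  unfold fiberLog
  rw [Finset.sum_eq_zero_iff_of_nonneg fun _ _ => Real.log_natCast_nonneg _]
  constructor
  · intro h p q hpq
    have hq := h q (Finset.mem_univ _)
    have hpos := fiberCard_pos F q
    have h1 : fiberCard F (F q) ≤ 1 := by
      by_contra! hlt
      exact (Real.log_pos (by exact_mod_cast hlt)).ne' hq
    exact Finset.card_le_one.1 h1 p (by simp [hpq]) q (by simp)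
  · intro h p _
    have : fiberCard F (F p) = 1 := Finset.card_eq_one.2 ⟨p, by ext q; simp [h.eq_iff]⟩
    simp [this]

lemma sum_negMulLog_fiberCard [Fintype Y] (F : P → Y) {r : ℝ} (hr : 0 < r) :
    ∑ y, Real.negMulLog (fiberCard F y / r) =
      (Fintype.card P * Real.log r - fiberLog F) / r := by
  have hterm : ∀ y, Real.negMulLog (fiberCard F y / r) =
      ∑ p with F p = y, (Real.log r - Real.log (fiberCard F (F p))) / r := by
    intro y
    have hconst : ∑ p with F p = y, (Real.log r - Real.log (fiberCard F (F p))) / r =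
        ∑ p with F p = y, (Real.log r - Real.log (fiberCard F y)) / r :=
      Finset.sum_congr rfl fun p hp => by rw [(Finset.mem_filter.1 hp).2]
    rw [hconst, Finset.sum_const, nsmul_eq_mul]
    change _ = (fiberCard F y : ℝ) * _
    rcases eq_or_ne (fiberCard F y) 0 with h0 | h0
    · simp [h0]
    · rw [Real.negMulLog, Real.log_div (by exact_mod_cast h0) hr.ne']
      ring
  simp_rw [hterm]
  rw [Finset.sum_fiberwise, ← Finset.sum_div, Finset.sum_sub_distrib]
  simp [fiberLog]

end fibers

section entropy
variable {m n : Type*} [Fintype m] [DecidableEq m] [Fintype n] [DecidableEq n]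

lemma vN_eq_sum_negMulLog {M : Matrix n n ℂ} (hM : M.IsHermitian) :
    vN M = ∑ k, Real.negMulLog (hM.eigenvalues k) := by
  simp [vN, hM, Real.negMulLog]

lemma vN_eq_sum_roots_charpoly {M : Matrix n n ℂ} (hM : M.IsHermitian) :
    vN M = (M.charpoly.roots.map fun z => Real.negMulLog z.re).sum := by
  rw [hM.roots_charpoly_eq_eigenvalues, vN_eq_sum_negMulLog hM]
  simp [Multiset.map_map]

lemma vN_diagonal (p : n → ℝ) :
    vN (Matrix.diagonal fun k => (p k : ℂ)) = ∑ k, Real.negMulLog (p k) := by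
  have h : (Matrix.diagonal fun k => (p k : ℂ)).IsHermitian := by
    rw [Matrix.IsHermitian, Matrix.diagonal_conjTranspose]
    congr 1
    ext k
    simp
  rw [vN_eq_sum_roots_charpoly h, Matrix.charpoly_diagonal,
    Polynomial.roots_prod _ _ (Finset.prod_ne_zero_iff.2 fun _ _ => Polynomial.X_sub_C_ne_zero _)]
  simp [Multiset.map_map]

lemma vN_mul_conjTranspose_comm (A : Matrix m n ℂ) : vN (A * Aᴴ) = vN (Aᴴ * A) := by
  rw [vN_eq_sum_roots_charpoly (Matrix.isHermitian_mul_conjTranspose_self A),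
    vN_eq_sum_roots_charpoly (Matrix.isHermitian_conjTranspose_mul_self A)]
  have h := congrArg Polynomial.roots (Matrix.charpoly_mul_comm' A Aᴴ)
  rw [Polynomial.roots_mul (mul_ne_zero (pow_ne_zero _ Polynomial.X_ne_zero)
      (Matrix.charpoly_monic _).ne_zero),
    Polynomial.roots_mul (mul_ne_zero (pow_ne_zero _ Polynomial.X_ne_zero)
      (Matrix.charpoly_monic _).ne_zero)] at h
  have h' := congrArg (fun s => (s.map fun z : ℂ => Real.negMulLog z.re).sum) h
  simpa [Multiset.map_nsmul, Multiset.sum_nsmul] using h'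

/-- Jensen's inequality for `negMulLog` with weights of total mass at most one. -/
lemma sum_mul_negMulLog_le {ι : Type*} [Fintype ι] (w q : ι → ℝ) (hw : ∀ k, 0 ≤ w k) (hq : ∀ k, 0 ≤ q k)
    (hw1 : ∑ k, w k ≤ 1) :
    ∑ k, w k * Real.negMulLog (q k) ≤ Real.negMulLog (∑ k, w k * q k) := by
  set l := ∑ k, w k * q k with hl
  have hl0 : 0 ≤ l := Finset.sum_nonneg fun k _ => mul_nonneg (hw k) (hq k)
  rcases hl0.eq_or_lt with h0 | hpos
  · have hz := (Finset.sum_eq_zero_iff_of_nonneg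
      fun k _ => mul_nonneg (hw k) (hq k)).1 (hl.symm.trans h0.symm)
    rw [← h0, Real.negMulLog_zero]
    refine (Finset.sum_eq_zero fun k hk => ?_).le
    rcases mul_eq_zero.1 (hz k hk) with h | h <;> simp [h]
  · have htangent : ∀ k, Real.negMulLog (q k) ≤ -q k * Real.log l + l - q k := by
      intro k
      rcases (hq k).eq_or_lt with h | h
      · simp [← h, hl0]
      · have hlog := Real.log_le_sub_one_of_pos (div_pos hpos h)
        rw [Real.log_div hpos.ne' h.ne'] at hlog
        have hmul := mul_le_mul_of_nonneg_left hlog h.le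
        have hcancel : q k * (l / q k - 1) = l - q k := by field_simp
        rw [Real.negMulLog]
        linarith
    calc ∑ k, w k * Real.negMulLog (q k)
        ≤ ∑ k, w k * (-q k * Real.log l + l - q k) :=
          Finset.sum_le_sum fun k _ => mul_le_mul_of_nonneg_left (htangent k) (hw k)
      _ = ∑ k, (-(Real.log l) * (w k * q k) + l * w k - w k * q k) :=
          Finset.sum_congr rfl fun k _ => by ring
      _ = -(Real.log l) * l + l * ∑ k, w k - l := by
          rw [Finset.sum_sub_distrib, Finset.sum_add_distrib, ← Finset.mul_sum,
            ← Finset.mul_sum]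
      _ ≤ Real.negMulLog l := by
          rw [Real.negMulLog]
          nlinarith

end entropy

/-- Entropy lower bound for the normalised Gram matrix of the indicator vectors of a set system
in which every point of `n` lies in exactly `r` of the sets. -/
lemma le_vN_gram {m n : Type*} [Fintype m] [Fintype n] [DecidableEq n] (C : m → Finset n) {r : ℝ} (hr : 0 < r)
    (hC : ∀ i, ((Finset.univ.filter fun t => i ∈ C t).card : ℝ) = r)
    (A : Matrix m n ℂ) (hA : ∀ t i, A t i = if i ∈ C t then (r : ℂ)⁻¹ else 0) :
    r⁻¹ * ∑ t, Real.negMulLog ((C t).card / r) ≤ vN (Aᴴ * A) := by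
  have hM := Matrix.isHermitian_conjTranspose_mul_self A
  rw [vN_eq_sum_negMulLog hM]
  set U : Matrix n n ℂ := (hM.eigenvectorUnitary : Matrix n n ℂ) with hU
  have hUU : Uᴴ * U = 1 := Matrix.mem_unitaryGroup_iff'.1 hM.eigenvectorUnitary.2
  have hUU' : U * Uᴴ = 1 := Matrix.mem_unitaryGroup_iff.1 hM.eigenvectorUnitary.2
  have hrow : ∀ i j, ∑ k, U i k * star (U j k) = if i = j then 1 else 0 := by
    intro i j
    simpa [Matrix.mul_apply, Matrix.one_apply] using congrFun (congrFun hUU' i) j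
  have hcol : ∀ k, ∑ i, ‖U i k‖ ^ 2 = 1 := by
    intro k
    have h := congrFun (congrFun hUU k) k
    simp only [Matrix.mul_apply, Matrix.conjTranspose_apply, Matrix.one_apply_eq,
      Complex.star_def, Complex.conj_mul'] at h
    exact_mod_cast h
  set g : m → n → ℝ := fun t k => ‖∑ i ∈ C t, U i k‖ ^ 2 with hg
  have hAU : ∀ t k, (A * U) t k = (r : ℂ)⁻¹ * ∑ i ∈ C t, U i k := by
    intro t k
    simp [Matrix.mul_apply, hA, Finset.mul_sum, ite_mul]
  have heig : ∀ k, hM.eigenvalues k = ∑ t, g t k / r ^ 2 := by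
    intro k
    have h1 : Uᴴ * (Aᴴ * A) * U = Matrix.diagonal (fun k => (hM.eigenvalues k : ℂ)) := by
      have := hM.conjStarAlgAut_star_eigenvectorUnitary
      simpa [Unitary.conjStarAlgAut_apply, Matrix.star_eq_conjTranspose, hU,
        Function.comp_def] using this
    have h2 : (A * U)ᴴ * (A * U) = Matrix.diagonal (fun k => (hM.eigenvalues k : ℂ)) := by
      rw [← h1, Matrix.conjTranspose_mul]
      simp only [Matrix.mul_assoc]
    have h3 := congrFun (congrFun h2 k) k
    simp only [Matrix.mul_apply (M := (A * U)ᴴ), Matrix.conjTranspose_apply,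
      Matrix.diagonal_apply_eq, Complex.star_def, Complex.conj_mul', hAU] at h3
    have h4 : ∑ t, ‖(r : ℂ)⁻¹ * ∑ i ∈ C t, U i k‖ ^ 2 = hM.eigenvalues k := by
      exact_mod_cast h3
    rw [← h4]
    refine Finset.sum_congr rfl fun t _ => ?_
    rw [norm_mul, norm_inv, Complex.norm_real, Real.norm_of_nonneg hr.le, hg]
    field_simp
  have hgle : ∀ t k, g t k ≤ (C t).card * ∑ i ∈ C t, ‖U i k‖ ^ 2 := fun t k =>
    (pow_le_pow_left₀ (norm_nonneg _) (norm_sum_le _ _) 2).trans sq_sum_le_card_mul_sum_sq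
  have hgsum : ∀ t, ∑ k, g t k = (C t).card := by
    intro t
    have h : ((∑ k, g t k : ℝ) : ℂ) = ((C t).card : ℂ) := by
      push_cast
      simp_rw [hg, Complex.ofReal_pow, ← Complex.mul_conj', ← Complex.star_def, star_sum,
        Finset.sum_mul_sum]
      rw [Finset.sum_comm]
      calc ∑ i ∈ C t, ∑ k, ∑ j ∈ C t, U i k * star (U j k)
          = ∑ i ∈ C t, ∑ j ∈ C t, ∑ k, U i k * star (U j k) :=
            Finset.sum_congr rfl fun i _ => Finset.sum_comm
        _ = ((C t).card : ℂ) := by simp_rw [hrow]; simp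
    exact_mod_cast h
  set w : n → m → ℝ := fun k t => g t k / ((C t).card * r) with hw
  have hw1 : ∀ k, ∑ t, w k t ≤ 1 := by
    intro k
    calc ∑ t, w k t ≤ ∑ t, (∑ i ∈ C t, ‖U i k‖ ^ 2) / r := by
          refine Finset.sum_le_sum fun t _ => ?_
          rcases eq_or_ne (C t).card 0 with h0 | h0
          · simp only [hw, h0, Nat.cast_zero, zero_mul, div_zero]
            positivity
          · have hc : (0 : ℝ) < (C t).card := by exact_mod_cast Nat.pos_of_ne_zero h0
            simp only [hw]
            rw [← div_div]
            gcongr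
            rw [div_le_iff₀ hc, mul_comm]
            exact hgle t k
      _ = (∑ i, ∑ t with i ∈ C t, ‖U i k‖ ^ 2) / r := by
          rw [← Finset.sum_div]
          congr 1
          exact Finset.sum_comm' (by simp)
      _ = 1 := by
          simp_rw [Finset.sum_const, nsmul_eq_mul, hC]
          rw [← Finset.mul_sum, hcol, mul_one, div_self hr.ne']
  have hwq : ∀ k, hM.eigenvalues k = ∑ t, w k t * ((C t).card / r) := by
    intro k
    rw [heig]
    refine Finset.sum_congr rfl fun t _ => ?_
    rcases Finset.eq_empty_or_nonempty (C t) with h0 | h0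
    · simp [hg, h0]
    · have hc : ((C t).card : ℝ) ≠ 0 := by exact_mod_cast h0.card_pos.ne'
      simp only [hw]
      field_simp
  calc r⁻¹ * ∑ t, Real.negMulLog ((C t).card / r)
      = ∑ t, (∑ k, w k t) * Real.negMulLog ((C t).card / r) := by
        rw [Finset.mul_sum]
        refine Finset.sum_congr rfl fun t _ => ?_
        rcases eq_or_ne (C t).card 0 with h0 | h0
        · simp [h0]
        · have hc : ((C t).card : ℝ) ≠ 0 := by exact_mod_cast h0
          simp only [hw]
          rw [← Finset.sum_div, hgsum]
          field_simp
    _ = ∑ k, ∑ t, w k t * Real.negMulLog ((C t).card / r) := by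
        simp_rw [Finset.sum_mul]
        exact Finset.sum_comm
    _ ≤ ∑ k, Real.negMulLog (hM.eigenvalues k) := by
        refine Finset.sum_le_sum fun k _ => ?_
        rw [hwq k]
        exact sum_mul_negMulLog_le _ _ (fun t => by positivity) (fun t => by positivity) (hw1 k)

lemma vN_diagonal_fiberCard {P Y : Type*} [Fintype P] [Fintype Y] [DecidableEq Y]
    [Nonempty P] (F : P → Y) :
    vN (Matrix.diagonal fun y => ((fiberCard F y / Fintype.card P : ℝ) : ℂ)) =
      Real.log (Fintype.card P) - fiberLog F / Fintype.card P := by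
  have hP : (0 : ℝ) < Fintype.card P := by exact_mod_cast Fintype.card_pos
  rw [vN_diagonal, sum_negMulLog_fiberCard F hP]
  field_simp

lemma vN_diagonal_uniform {n : Type*} [Fintype n] [DecidableEq n] [Nonempty n] :
    vN (Matrix.diagonal fun _ : n => (((Fintype.card n : ℝ)⁻¹ : ℝ) : ℂ)) =
      Real.log (Fintype.card n) := by
  have hn : (0 : ℝ) < Fintype.card n := by exact_mod_cast Fintype.card_pos
  rw [vN_diagonal, Finset.sum_const, Finset.card_univ, nsmul_eq_mul, Real.negMulLog,
    Real.log_inv]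
  field_simp

section permFamilies
variable {ι S : Type*}

/-- The pairs of images of a point under two families of permutations. -/
def pairMap (f g : ι → Equiv.Perm S) (p : ι × S) : S × S :=
  (f p.1 p.2, g p.1 p.2)

/-- The triples of images of a point under three families of permutations. -/
def tripleMap (f g h : ι → Equiv.Perm S) (p : ι × S) : S × S × S :=
  (f p.1 p.2, g p.1 p.2, h p.1 p.2)

lemma injective_tripleMap_of_pairMap {f g : ι → Equiv.Perm S} (h : ι → Equiv.Perm S)
    (hfg : Function.Injective (pairMap f g)) : Function.Injective (tripleMap f g h) := by
  intro p q hpq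
  simp only [tripleMap, Prod.mk.injEq] at hpq
  exact hfg (Prod.ext hpq.1 hpq.2.1)

variable [Fintype S] [DecidableEq S]

lemma sum_tripleMap_eq (f g h : ι → Equiv.Perm S) (i : ι) (x : S × S × S) :
    (∑ s, if x = tripleMap f g h (i, s) then (1 : ℂ) else 0) =
      if ∃ s, x = tripleMap f g h (i, s) then 1 else 0 := by
  split_ifs with hx
  · obtain ⟨s, rfl⟩ := hx
    rw [Finset.sum_eq_single s]
    · simp
    · intro t _ hts
      simp [tripleMap, hts.symm]
    · simp
  · push Not at hx
    simp [hx]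

lemma card_filter_mem_tripleMap (f g h : ι → Equiv.Perm S) (i : ι) :
    (Finset.univ.filter fun x => ∃ s, x = tripleMap f g h (i, s)).card = Fintype.card S := by
  have hinj : Function.Injective fun s => tripleMap f g h (i, s) := by
    intro s t hst
    simpa [tripleMap] using hst
  rw [← Finset.card_univ, ← Finset.card_image_of_injective _ hinj]
  congr 1
  ext x
  simp [eq_comm]

variable [Fintype ι]

lemma fiberCard_pairMap (f g : ι → Equiv.Perm S) (x y : S) :
    fiberCard (pairMap f g) (x, y) = ∑ i, ∑ s, if x = f i s ∧ y = g i s then 1 else 0 := by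
  rw [fiberCard, Finset.card_filter, Fintype.sum_prod_type]
  simp [pairMap, eq_comm]

lemma sum_fiberCard_pairMap_right (f g : ι → Equiv.Perm S) (x : S) :
    ∑ y, fiberCard (pairMap f g) (x, y) = Fintype.card ι := by
  simp_rw [fiberCard_pairMap]
  rw [Finset.sum_comm]
  have hi : ∀ i, (∑ y, ∑ s, if x = f i s ∧ y = g i s then 1 else 0) = 1 := by
    intro i
    rw [Finset.sum_comm, ← Equiv.sum_comp (f i).symm]
    simp [ite_and]
  simp_rw [hi]
  simp

lemma sum_fiberCard_pairMap_left (f g : ι → Equiv.Perm S) (y : S) :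
    ∑ x, fiberCard (pairMap f g) (x, y) = Fintype.card ι := by
  rw [← sum_fiberCard_pairMap_right g f y]
  simp_rw [fiberCard_pairMap, and_comm]

/-- Tracing out the third factor leaves a diagonal matrix of fibre sizes. -/
lemma sum_mul_eq_fiberCard_pairMap (f g h : ι → Equiv.Perm S) (N : ι → S → S → S → ℂ)
    (hN : ∀ i x y z, N i x y z = ∑ s, if x = f i s ∧ y = g i s ∧ z = h i s then 1 else 0)
    (p q : S × S) :
    ∑ z, ∑ i, N i p.1 p.2 z * N i q.1 q.2 z =
      if p = q then (fiberCard (pairMap f g) p : ℂ) else 0 := by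
  obtain ⟨x, y⟩ := p
  obtain ⟨x', y'⟩ := q
  have hN' : ∀ i x y s, N i x y (h i s) = if x = f i s ∧ y = g i s then 1 else 0 := by
    intro i x y s
    rw [hN, Finset.sum_eq_single s]
    · simp
    · intro t _ hts
      simp [hts.symm]
    · simp
  rw [Finset.sum_comm, fiberCard_pairMap]
  have hi : ∀ i, ∑ z, N i x y z * N i x' y' z = ∑ s, (if x = f i s ∧ y = g i s then 1 else 0) *
      if x' = f i s ∧ y' = g i s then 1 else 0 := by
    intro i
    rw [← Equiv.sum_comp (h i)]
    simp_rw [hN']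
  simp_rw [hi]
  split_ifs with heq
  · obtain ⟨rfl, rfl⟩ := Prod.mk.injEq .. ▸ heq
    push_cast
    refine Finset.sum_congr rfl fun i _ => Finset.sum_congr rfl fun s _ => ?_
    split_ifs <;> simp
  · refine Finset.sum_eq_zero fun i _ => Finset.sum_eq_zero fun s _ => ?_
    rw [ite_zero_mul_ite_zero, if_neg]
    rintro ⟨⟨rfl, rfl⟩, rfl, rfl⟩
    exact heq rfl

lemma card_filter_exists_tripleMap (f g h : ι → Equiv.Perm S) (x : S × S × S) :
    (Finset.univ.filter fun i => ∃ s, x = tripleMap f g h (i, s)).card =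
      fiberCard (tripleMap f g h) x := by
  classical
  symm
  refine Finset.card_bij (fun p _ => p.1) ?_ ?_ ?_
  · rintro ⟨i, s⟩ hp
    simp only [Finset.mem_filter, Finset.mem_univ, true_and] at hp ⊢
    exact ⟨s, hp.symm⟩
  · rintro ⟨i, s⟩ hp ⟨j, t⟩ hq hij
    simp only [Finset.mem_filter, Finset.mem_univ, true_and] at hp hq hij
    subst hij
    have := hp.trans hq.symm
    simp only [tripleMap, Prod.mk.injEq, EmbeddingLike.apply_eq_iff_eq] at this
    rw [this.1]
  · intro i hi
    simp only [Finset.mem_filter, Finset.mem_univ, true_and] at hi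
    obtain ⟨s, hs⟩ := hi
    exact ⟨(i, s), by simp [hs], rfl⟩

end permFamilies

lemma injective_pairMap_pow_iff {d : ℕ} {S : Type*} (σ τ : Equiv.Perm S) :
    Function.Injective (pairMap (fun i : Fin d => σ ^ (i.val + 1)) fun i => τ ^ (i.val + 1)) ↔
      ∀ s, ∀ i : ℕ, 1 ≤ i → i ≤ d - 1 → (σ ^ i) s ≠ (τ ^ i) s := by
  constructor
  · intro h s i hi hid heq
    have hd : i < d := by omega
    have key := @h (⟨i, hd⟩, s) (⟨0, by omega⟩, (σ ^ i) s) (by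
      simp only [pairMap, zero_add, pow_one, Prod.mk.injEq]
      refine ⟨by rw [pow_succ', Equiv.Perm.mul_apply], ?_⟩
      rw [heq, pow_succ', Equiv.Perm.mul_apply])
    simp only [Prod.mk.injEq, Fin.mk.injEq] at key
    omega
  · intro h
    have hle : ∀ p q : Fin d × S, p.1 ≤ q.1 →
        pairMap (fun i : Fin d => σ ^ (i.val + 1)) (fun i => τ ^ (i.val + 1)) p =
          pairMap (fun i : Fin d => σ ^ (i.val + 1)) (fun i => τ ^ (i.val + 1)) q → p = q := by
      rintro ⟨i, s⟩ ⟨j, t⟩ hij hpq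
      obtain ⟨k, hk⟩ := Nat.exists_eq_add_of_le (Fin.le_def.1 hij)
      have hexp : (j : ℕ) + 1 = (i + 1) + k := by simp only at hk; omega
      simp only [pairMap, Prod.mk.injEq, hexp, pow_add _ ((i : ℕ) + 1) k,
        Equiv.Perm.mul_apply, EmbeddingLike.apply_eq_iff_eq] at hpq
      rcases Nat.eq_zero_or_pos k with rfl | hk0
      · exact Prod.ext (Fin.ext (by simpa using hk.symm)) (by simpa using hpq.1)
      · exact absurd (hpq.1.symm.trans hpq.2) (h t k hk0 (by simp only at hk; omega))
    intro p q hpq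
    rcases le_total p.1 q.1 with hl | hl
    · exact hle p q hl hpq
    · exact (hle q p hl hpq.symm).symm

/-- Tripartite information of the maximally mixed state on a permutation code space, expressed
through fibre sizes and the entropy of the global state. -/
lemma I3_permCode {ι S : Type*} [Fintype ι] [Fintype S] [DecidableEq S] [Nonempty ι] [Nonempty S]
    (f g h : ι → Equiv.Perm S) (ρ : Matrix (S × S × S) (S × S × S) ℂ)
    (hρ : ∀ x y, ρ x y = ((Fintype.card (ι × S) : ℝ) : ℂ)⁻¹ * ∑ i,
      (∑ s, if x = tripleMap f g h (i, s) then 1 else 0) *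
        ∑ s, if y = tripleMap f g h (i, s) then 1 else 0) :
    I3 ρ = 3 * Real.log (Fintype.card S) - 3 * Real.log (Fintype.card (ι × S)) +
      (fiberLog (pairMap f g) + fiberLog (pairMap f h) + fiberLog (pairMap g h)) /
        Fintype.card (ι × S) + vN ρ := by
  have hdiag : ∀ (M : Matrix (S × S) (S × S) ℂ) (f g h : ι → Equiv.Perm S)
      (N : ι → S → S → S → ℂ),
      (∀ i x y z, N i x y z = ∑ s, if x = f i s ∧ y = g i s ∧ z = h i s then 1 else 0) →
      (∀ p q, M p q = ∑ z, ((Fintype.card (ι × S) : ℝ) : ℂ)⁻¹ *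
        ∑ i, N i p.1 p.2 z * N i q.1 q.2 z) →
      M = Matrix.diagonal
        fun y => ((fiberCard (pairMap f g) y / Fintype.card (ι × S) : ℝ) : ℂ) := by
    intro M f g h N hN hM
    ext p q
    rw [hM, ← Finset.mul_sum, sum_mul_eq_fiberCard_pairMap f g h N hN, Matrix.diagonal_apply]
    split_ifs
    · push_cast
      ring
    · simp
  have h12 := hdiag (red12 ρ) f g h
    (fun i x y z => ∑ s, if (x, y, z) = tripleMap f g h (i, s) then 1 else 0)
    (fun i x y z => by simp [tripleMap]) (fun p q => by simp [red12, hρ])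
  have h13 := hdiag (red13 ρ) f h g
    (fun i x y z => ∑ s, if (x, z, y) = tripleMap f g h (i, s) then 1 else 0)
    (fun i x y z => by simp [tripleMap, and_comm]) (fun p q => by simp [red13, hρ])
  have h23 := hdiag (red23 ρ) g h f
    (fun i x y z => ∑ s, if (z, x, y) = tripleMap f g h (i, s) then 1 else 0)
    (fun i x y z => by simp [tripleMap, and_left_comm, and_comm])
    (fun p q => by simp [red23, hρ])
  have hι : (Fintype.card ι : ℂ) ≠ 0 := by exact_mod_cast Fintype.card_ne_zero
  have hS : (Fintype.card S : ℂ) ≠ 0 := by exact_mod_cast Fintype.card_ne_zero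
  have hright : ∀ (f g : ι → Equiv.Perm S) (x : S),
      ∑ y, (fiberCard (pairMap f g) (x, y) : ℂ) = Fintype.card ι := fun f g x => by
    exact_mod_cast sum_fiberCard_pairMap_right f g x
  have hleft : ∀ (f g : ι → Equiv.Perm S) (y : S),
      ∑ x, (fiberCard (pairMap f g) (x, y) : ℂ) = Fintype.card ι := fun f g y => by
    exact_mod_cast sum_fiberCard_pairMap_left f g y
  have h1 : red1 ρ = Matrix.diagonal fun _ => (((Fintype.card S : ℝ)⁻¹ : ℝ) : ℂ) := by
    ext a a'
    change ∑ b, red12 ρ (a, b) (a', b) = _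
    simp only [h12, Matrix.diagonal_apply, Prod.mk.injEq, and_true]
    split_ifs
    · push_cast
      rw [← Finset.sum_div, hright, Fintype.card_prod]
      push_cast
      field_simp
    · simp
  have h2 : red2 ρ = Matrix.diagonal fun _ => (((Fintype.card S : ℝ)⁻¹ : ℝ) : ℂ) := by
    ext b b'
    change ∑ a, red12 ρ (a, b) (a, b') = _
    simp only [h12, Matrix.diagonal_apply, Prod.mk.injEq, true_and]
    split_ifs
    · push_cast
      rw [← Finset.sum_div, hleft, Fintype.card_prod]
      push_cast
      field_simp
    · simp
  have h3 : red3 ρ = Matrix.diagonal fun _ => (((Fintype.card S : ℝ)⁻¹ : ℝ) : ℂ) := by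
    ext c c'
    change ∑ a, red13 ρ (a, c) (a, c') = _
    simp only [h13, Matrix.diagonal_apply, Prod.mk.injEq, true_and]
    split_ifs
    · push_cast
      rw [← Finset.sum_div, hleft, Fintype.card_prod]
      push_cast
      field_simp
    · simp
  rw [I3, h1, h2, h3, h12, h13, h23, vN_diagonal_uniform, vN_diagonal_fiberCard,
    vN_diagonal_fiberCard, vN_diagonal_fiberCard]
  ring

section globalEntropy
variable {ι S : Type*} [Fintype ι] [DecidableEq ι] [Fintype S] [DecidableEq S] [Nonempty S]
  (f g h : ι → Equiv.Perm S) (A : Matrix (S × S × S) ι ℂ)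

lemma le_vN_permCode
    (hA : ∀ x i, A x i =
      if ∃ s, x = tripleMap f g h (i, s) then ((Fintype.card S : ℝ) : ℂ)⁻¹ else 0) :
    (Fintype.card (ι × S) * Real.log (Fintype.card S) - fiberLog (tripleMap f g h)) /
      (Fintype.card S) ^ 2 ≤ vN (A * Aᴴ) := by
  have hS : (0 : ℝ) < Fintype.card S := by exact_mod_cast Fintype.card_pos
  have key := le_vN_gram
    (fun x => Finset.univ.filter fun i => ∃ s, x = tripleMap f g h (i, s)) hS
    (fun i => by simp [card_filter_mem_tripleMap]) A (fun x i => by simp [hA])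
  simp_rw [card_filter_exists_tripleMap] at key
  rw [sum_negMulLog_fiberCard _ hS, ← vN_mul_conjTranspose_comm] at key
  convert key using 1
  field_simp

lemma vN_permCode_of_injective [Nonempty ι]
    (hA : ∀ x i, A x i =
      if ∃ s, x = tripleMap f g h (i, s) then ((Fintype.card S : ℝ) : ℂ)⁻¹ else 0)
    (hinj : Function.Injective (tripleMap f g h))
    (hcard : Fintype.card ι = Fintype.card S) :
    vN (A * Aᴴ) = Real.log (Fintype.card S) := by
  have hS : (Fintype.card S : ℂ) ≠ 0 := by exact_mod_cast Fintype.card_ne_zero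
  have hdiag : Aᴴ * A = Matrix.diagonal fun _ => (((Fintype.card ι : ℝ)⁻¹ : ℝ) : ℂ) := by
    ext i j
    simp only [Matrix.mul_apply, Matrix.conjTranspose_apply, Matrix.diagonal_apply, hA]
    split_ifs with hij
    · subst hij
      simp only [Complex.star_def, Complex.conj_mul']
      have hterm : ∀ x, ((‖if ∃ s, x = tripleMap f g h (i, s) then
          ((Fintype.card S : ℝ) : ℂ)⁻¹ else 0‖ : ℂ)) ^ 2 =
          if ∃ s, x = tripleMap f g h (i, s) then ((Fintype.card S : ℂ) ^ 2)⁻¹ else 0 := by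
        intro x
        split_ifs <;> simp
      simp_rw [hterm]
      rw [← Finset.sum_filter, Finset.sum_const, card_filter_mem_tripleMap, hcard, nsmul_eq_mul]
      push_cast
      field_simp
    · refine Finset.sum_eq_zero fun x _ => ?_
      split_ifs with h1 h2 <;> simp
      obtain ⟨s, rfl⟩ := h1
      obtain ⟨t, ht⟩ := h2
      exact hij (congrArg Prod.fst (hinj ht))
  rw [vN_mul_conjTranspose_comm, hdiag, vN_diagonal_uniform, hcard]

end globalEntropy

/-- the permutation code space given by `σ1, σ2, σ3` has minimal tripartite
information `I₃ = −2 log d` (for the maximally mixed density) if and only if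
`σ_a^i(s) ≠ σ_b^i(s)` for all distinct `a, b`, all `s` and all `i ∈ {1,…,d−1}`. -/
theorem stmt14 (d : ℕ) (hd : 1 ≤ d) (σ1 σ2 σ3 : Equiv.Perm (Fin d))
    (v : Fin d → (Fin d × Fin d × Fin d) → ℂ)
    (hv : ∀ i x, v i x = (Real.sqrt d : ℂ)⁻¹ * ∑ s : Fin d,
        (if x = ((σ1 ^ (i.val + 1)) s, (σ2 ^ (i.val + 1)) s, (σ3 ^ (i.val + 1)) s)
         then 1 else 0))
    (ρ : Matrix (Fin d × Fin d × Fin d) (Fin d × Fin d × Fin d) ℂ)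
    (hρ : ρ = (d : ℂ)⁻¹ • ∑ i, outer (v i) (v i)) :
    I3 ρ = -2 * Real.log d ↔
      ∀ a b : Fin 3, a ≠ b → ∀ s : Fin d, ∀ i : ℕ, 1 ≤ i → i ≤ d - 1 →
        ((![σ1, σ2, σ3] a) ^ i) s ≠ ((![σ1, σ2, σ3] b) ^ i) s := by
  have : NeZero d := ⟨by omega⟩
  have hd0 : (0 : ℝ) < d := by exact_mod_cast hd
  set f : Fin d → Equiv.Perm (Fin d) := fun i => σ1 ^ (i.val + 1) with hf
  set g : Fin d → Equiv.Perm (Fin d) := fun i => σ2 ^ (i.val + 1) with hg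
  set h : Fin d → Equiv.Perm (Fin d) := fun i => σ3 ^ (i.val + 1) with hh
  have hsqrt : ((Real.sqrt d : ℂ)⁻¹) * (Real.sqrt d : ℂ)⁻¹ = (d : ℂ)⁻¹ := by
    rw [← mul_inv, ← Complex.ofReal_mul, Real.mul_self_sqrt hd0.le, Complex.ofReal_natCast]
  have hρ' : ∀ x y, ρ x y = ((Fintype.card (Fin d × Fin d) : ℝ) : ℂ)⁻¹ * ∑ i,
      (∑ s, if x = tripleMap f g h (i, s) then 1 else 0) *
        ∑ s, if y = tripleMap f g h (i, s) then 1 else 0 := by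
    intro x y
    have hstar : ∀ i, star (v i y) = v i y := by
      intro i
      rw [hv]
      simp
    simp only [hρ, Matrix.smul_apply, Matrix.sum_apply, outer, Matrix.of_apply, hstar, smul_eq_mul]
    simp only [hv, mul_mul_mul_comm, hsqrt, ← Finset.mul_sum]
    rw [← mul_assoc]
    congr 1
    simp
  set A : Matrix (Fin d × Fin d × Fin d) (Fin d) ℂ := Matrix.of fun x i =>
    if ∃ s, x = tripleMap f g h (i, s) then ((Fintype.card (Fin d) : ℝ) : ℂ)⁻¹ else 0 with hA
  have hAx : ∀ x i, A x i =
      if ∃ s, x = tripleMap f g h (i, s) then ((Fintype.card (Fin d) : ℝ) : ℂ)⁻¹ else 0 := by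
    intro x i
    rw [hA, Matrix.of_apply]
  have hAρ : ρ = A * Aᴴ := by
    ext x y
    rw [hρ', Matrix.mul_apply, Finset.mul_sum]
    refine Finset.sum_congr rfl fun i _ => ?_
    rw [sum_tripleMap_eq, sum_tripleMap_eq, Matrix.conjTranspose_apply, hAx, hAx]
    split_ifs <;> simp
  have hI := I3_permCode f g h ρ hρ'
  have hlow := le_vN_permCode f g h A fun x i => by convert hAx x i
  rw [← hAρ] at hlow
  simp only [Fintype.card_prod, Fintype.card_fin, Nat.cast_mul] at hI hlow
  rw [Real.log_mul hd0.ne' hd0.ne'] at hI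
  have hcond : (∀ a b : Fin 3, a ≠ b → ∀ s : Fin d, ∀ i : ℕ, 1 ≤ i → i ≤ d - 1 →
        ((![σ1, σ2, σ3] a) ^ i) s ≠ ((![σ1, σ2, σ3] b) ^ i) s) ↔
      Function.Injective (pairMap f g) ∧ Function.Injective (pairMap f h) ∧
        Function.Injective (pairMap g h) := by
    simp only [hf, hg, hh, injective_pairMap_pow_iff]
    constructor
    · intro H
      exact ⟨H 0 1 (by decide), H 0 2 (by decide), H 1 2 (by decide)⟩
    · rintro ⟨h12, h13, h23⟩ a b hab s i hi hid
      fin_cases a <;> fin_cases b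
      exacts [absurd rfl hab, h12 s i hi hid, h13 s i hi hid, (h12 s i hi hid).symm,
        absurd rfl hab, h23 s i hi hid, (h13 s i hi hid).symm, (h23 s i hi hid).symm,
        absurd rfl hab]
  rw [hcond]
  constructor
  · intro hmin
    have n12 := fiberLog_nonneg (pairMap f g)
    have n13 := fiberLog_nonneg (pairMap f h)
    have n23 := fiberLog_nonneg (pairMap g h)
    have l12 : fiberLog (tripleMap f g h) ≤ fiberLog (pairMap f g) :=
      fiberLog_le_comp (tripleMap f g h) fun x => (x.1, x.2.1)
    have l23 : fiberLog (tripleMap f g h) ≤ fiberLog (pairMap g h) :=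
      fiberLog_le_comp (tripleMap f g h) fun x => x.2
    have hsum : fiberLog (pairMap f g) + fiberLog (pairMap f h) + fiberLog (pairMap g h) ≤
        fiberLog (tripleMap f g h) := by
      rw [hmin] at hI
      have hexpand : (d * d * Real.log d - fiberLog (tripleMap f g h)) / (d : ℝ) ^ 2 =
          Real.log d - fiberLog (tripleMap f g h) / (d * d) := by
        field_simp
      rw [hexpand] at hlow
      exact (div_le_div_iff_of_pos_right (mul_pos hd0 hd0)).1 (by linarith)
    simp only [← fiberLog_eq_zero_iff]
    exact ⟨by linarith, by linarith, by linarith⟩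
  · rintro ⟨h12, h13, h23⟩
    have hvN := vN_permCode_of_injective f g h A (fun x i => by convert hAx x i)
      (injective_tripleMap_of_pairMap h h12) rfl
    rw [← hAρ, Fintype.card_fin] at hvN
    rw [hI, (fiberLog_eq_zero_iff _).2 h12, (fiberLog_eq_zero_iff _).2 h13,
      (fiberLog_eq_zero_iff _).2 h23, hvN]
    ring
end
end

section
/- Let d ≥ 1 and let σ, τ be permutations of Fin d. The map from {1,…,d} × Fin d to Fin d × Fin d given by (i,s) ↦ (σ^i(s), τ^i(s)) is injective if and only if σ^i(s) ≠ τ^i(s) for all s ∈ Fin d and all i ∈ {1,…,d−1}. -/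
open Matrix MeasureTheory ProbabilityTheory
open scoped ComplexOrder BigOperators

noncomputable section

/-- the map `(i, s) ↦ (σ^i(s), τ^i(s))` is injective on `{1,…,d} × Fin d` if and
only if `σ^i(s) ≠ τ^i(s)` for all `s` and all `i ∈ {1,…,d−1}`. -/
theorem stmt15 (d : ℕ) (hd : 1 ≤ d) (σ τ : Equiv.Perm (Fin d)) :
    Set.InjOn (fun p : ℕ × Fin d => ((σ ^ p.1) p.2, (τ ^ p.1) p.2))
        ((Set.Icc 1 d) ×ˢ (Set.univ : Set (Fin d))) ↔
      ∀ s : Fin d, ∀ i : ℕ, 1 ≤ i → i ≤ d - 1 → (σ ^ i) s ≠ (τ ^ i) s := by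
  constructor
  · intro h s i h1 h2 heq
    have key := @h (i + 1, s) ⟨⟨by omega, by omega⟩, trivial⟩ (1, (σ ^ i) s)
      ⟨⟨le_rfl, hd⟩, trivial⟩
      (Prod.ext (by simp [pow_succ']) (by simp [pow_succ', heq]))
    have := congrArg Prod.fst key
    simp only at this
    omega
  · intro h
    have no_collision : ∀ i j : ℕ, ∀ s t : Fin d, 1 ≤ j → j < i → i ≤ d →
        (σ ^ i) s = (σ ^ j) t → (τ ^ i) s ≠ (τ ^ j) t := by
      intro i j s t hj hji hi hσ hτ
      obtain ⟨k, rfl⟩ := Nat.exists_eq_add_of_lt hji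
      rw [add_assoc, pow_add, Equiv.Perm.mul_apply, EmbeddingLike.apply_eq_iff_eq] at hσ hτ
      exact h s (k + 1) (by omega) (by omega) (hσ.trans hτ.symm)
    rintro ⟨i, s⟩ ⟨⟨hi1, hi2⟩, -⟩ ⟨j, t⟩ ⟨⟨hj1, hj2⟩, -⟩ heq
    obtain ⟨hσ, hτ⟩ := Prod.mk.inj heq
    dsimp only at *
    rcases lt_trichotomy i j with hlt | rfl | hlt
    · exact absurd hτ.symm (no_collision j i t s hi1 hlt hj2 hσ.symm)
    · rw [(σ ^ i).injective hσ]
    · exact absurd hτ (no_collision i j s t hj1 hlt hi2 hσ)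
end
end

section
/- Let d ≥ 1 and let k1, k2 ∈ ZMod d be such that k1, k2 and k1 − k2 are all units of ZMod d. Define t : (ZMod d)⁴ → ℂ by t(i,s1,s2,s3) = 1 if s2 = s1 + k1·i and s3 = s1 + k2·i, and t(i,s1,s2,s3) = 0 otherwise. Then all three d²×d² matrices t⁽¹⁾((s2,s3),(i,s1)) = t(i,s1,s2,s3), t⁽²⁾((s1,s3),(i,s2)) = t(i,s1,s2,s3), and t⁽³⁾((s1,s2),(i,s3)) = t(i,s1,s2,s3) are unitary, i.e. t is multi-unitary. (For d prime this hypothesis reduces to the paper's condition that k1 ≠ k2 and both are nonzero mod d.) -/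
open Matrix MeasureTheory ProbabilityTheory
open scoped ComplexOrder BigOperators

noncomputable section

/-- the 0-1 matrix of an injective self-map of a finite type is unitary -/
theorem isUnitaryM_of_injective {A : Type*} [Fintype A] [DecidableEq A] {f : A → A}
    (hf : Function.Injective f) {M : Matrix A A ℂ}
    (hM : ∀ p q, M p q = if p = f q then 1 else 0) : IsUnitaryM M := by
  have h : Mᴴ * M = 1 := by
    ext q r
    simp [Matrix.mul_apply, hM, Matrix.one_apply, hf.eq_iff, eq_comm]
  exact ⟨mul_eq_one_comm.mp h, h⟩

/-- two lines of slopes `a` and `b` through a common point determine it when `a - b` is a unit -/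
theorem injective_shift_pair {R : Type*} [CommRing R] {a b : R} (hab : IsUnit (a - b)) :
    Function.Injective fun q : R × R => (q.2 + a * q.1, q.2 + b * q.1) := by
  rintro ⟨i, s⟩ ⟨j, r⟩ h
  obtain ⟨ha, hb⟩ := Prod.mk.inj h
  have hij : i = j := hab.mul_left_cancel (by linear_combination ha - hb)
  subst hij
  exact Prod.ext rfl (add_right_cancel ha)

/-- the shift tensor `t(i,s1,s2,s3) = [s2 = s1 + k1 i][s3 = s1 + k2 i]` is
multi-unitary whenever `k1`, `k2` and `k1 − k2` are units of `ZMod d`. (The hypothesis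
`NeZero d` is the statement `d ≥ 1`.) -/
theorem stmt16 (d : ℕ) [NeZero d] (k1 k2 : ZMod d)
    (h1 : IsUnit k1) (h2 : IsUnit k2) (h12 : IsUnit (k1 - k2))
    (t : ZMod d → ZMod d → ZMod d → ZMod d → ℂ)
    (ht : ∀ i s1 s2 s3, t i s1 s2 s3 =
        if s2 = s1 + k1 * i ∧ s3 = s1 + k2 * i then 1 else 0) :
    IsUnitaryM (Matrix.of fun p q : ZMod d × ZMod d => t q.1 q.2 p.1 p.2) ∧
    IsUnitaryM (Matrix.of fun p q : ZMod d × ZMod d => t q.1 p.1 q.2 p.2) ∧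
    IsUnitaryM (Matrix.of fun p q : ZMod d × ZMod d => t q.1 p.1 p.2 q.2) := by
  refine ⟨isUnitaryM_of_injective (injective_shift_pair h12) fun p q => ?_,
    isUnitaryM_of_injective (injective_shift_pair (a := -k1) (b := k2 - k1) ?_) fun p q => ?_,
    isUnitaryM_of_injective (injective_shift_pair (a := -k2) (b := k1 - k2) ?_) fun p q => ?_⟩
  · simp only [Matrix.of_apply, ht, Prod.ext_iff]
  · convert h2.neg using 1
    ring
  · simp only [Matrix.of_apply, ht, Prod.ext_iff]
    congr 1
    grind
  · convert h1.neg using 1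
    ring
  · simp only [Matrix.of_apply, ht, Prod.ext_iff]
    congr 1
    grind
end
end

section
/- Let d ≥ 1 and let ω = exp(2πi/d). Define t : (ZMod d)⁴ → ℂ by t(i,j,k,l) = d^{-1/2}·ω^{i·l} if j = i + k, and t(i,j,k,l) = 0 otherwise, where the exponent i·l is computed in ZMod d (well-defined since ω^d = 1). Then the two d²×d² matrices T1((k,l),(i,j)) := t(i,j,k,l) and T2((j,l),(i,k)) := t(i,j,k,l) are unitary. -/
open Matrix MeasureTheory ProbabilityTheory
open scoped ComplexOrder BigOperators

noncomputable section

/-- `ω^x = exp(2πi·x̃/d)` for `x : ZMod d`, where `x̃ = x.val` is the canonical representative. -/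
def omegaPow (d : ℕ) [NeZero d] (x : ZMod d) : ℂ :=
  Complex.exp (2 * Real.pi * Complex.I * (x.val : ℂ) / d)

theorem omegaPow_eq_stdAddChar (d : ℕ) [NeZero d] (x : ZMod d) :
    omegaPow d x = ZMod.stdAddChar x := by
  rw [ZMod.stdAddChar_apply, ZMod.toCircle_apply, omegaPow]

theorem star_omegaPow (d : ℕ) [NeZero d] (x : ZMod d) :
    star (omegaPow d x) = omegaPow d (-x) := by
  rw [omegaPow_eq_stdAddChar, omegaPow_eq_stdAddChar, AddChar.map_neg_eq_conj]
  rfl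

theorem sum_omegaPow_mul_star (d : ℕ) [NeZero d] (l l' : ZMod d) :
    ∑ i : ZMod d, ((Real.sqrt d : ℂ)⁻¹ * omegaPow d (i * l)) *
      star ((Real.sqrt d : ℂ)⁻¹ * omegaPow d (i * l')) = if l = l' then 1 else 0 := by
  have hd : (d : ℂ) ≠ 0 := Nat.cast_ne_zero.2 (NeZero.ne d)
  have hs : (Real.sqrt d : ℂ) * (Real.sqrt d : ℂ) = d := by
    rw [← Complex.ofReal_mul, Real.mul_self_sqrt (Nat.cast_nonneg d), Complex.ofReal_natCast]
  have hterm (i : ZMod d) : ((Real.sqrt d : ℂ)⁻¹ * omegaPow d (i * l)) *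
      star ((Real.sqrt d : ℂ)⁻¹ * omegaPow d (i * l')) =
      (d : ℂ)⁻¹ * ZMod.stdAddChar (i * (l - l')) := by
    have hr : star ((Real.sqrt d : ℂ)⁻¹) = (Real.sqrt d : ℂ)⁻¹ := by
      rw [← Complex.ofReal_inv]
      exact Complex.conj_ofReal _
    rw [star_mul', hr, star_omegaPow, omegaPow_eq_stdAddChar, omegaPow_eq_stdAddChar,
      mul_mul_mul_comm, ← mul_inv, hs, ← AddChar.map_add_eq_mul, mul_sub, sub_eq_add_neg]
  simp_rw [hterm]
  rw [← Finset.mul_sum, AddChar.sum_mulShift _ (ZMod.isPrimitive_stdAddChar d)]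
  simp [sub_eq_zero, hd]

theorem isUnitaryM_of_mul_conjTranspose {A : Type*} [Fintype A] [DecidableEq A]
    {U : Matrix A A ℂ} (h : U * Uᴴ = 1) : IsUnitaryM U :=
  ⟨h, mul_eq_one_comm.1 h⟩

/-- for the VIP tensor `t(i,j,k,l) = d^{-1/2} ω^{il} [j = i + k]`, the
matrices `T1((k,l),(i,j)) = t(i,j,k,l)` and `T2((j,l),(i,k)) = t(i,j,k,l)` are unitary. -/
theorem stmt17 (d : ℕ) [NeZero d]
    (t : ZMod d → ZMod d → ZMod d → ZMod d → ℂ)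
    (ht : ∀ i j k l, t i j k l =
        if j = i + k then (Real.sqrt d : ℂ)⁻¹ * omegaPow d (i * l) else 0) :
    IsUnitaryM (Matrix.of fun p q : ZMod d × ZMod d => t q.1 q.2 p.1 p.2) ∧
    IsUnitaryM (Matrix.of fun p q : ZMod d × ZMod d => t q.1 p.1 q.2 p.2) := by
  constructor
  · refine isUnitaryM_of_mul_conjTranspose ?_
    ext ⟨k, l⟩ ⟨k', l'⟩
    simp only [Matrix.mul_apply, Matrix.conjTranspose_apply, Matrix.of_apply, ht,
      Fintype.sum_prod_type, ite_mul, zero_mul, Finset.sum_ite_eq',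
      Finset.mem_univ, if_true, add_right_inj, Matrix.one_apply, Prod.mk.injEq]
    by_cases hk : k = k'
    · simpa only [hk, if_true, true_and] using sum_omegaPow_mul_star d l l'
    · simp [hk]
  · refine isUnitaryM_of_mul_conjTranspose ?_
    ext ⟨j, l⟩ ⟨j', l'⟩
    have hjk (j i k : ZMod d) : j = i + k ↔ k = j - i := by
      rw [eq_sub_iff_add_eq', eq_comm]
    simp only [Matrix.mul_apply, Matrix.conjTranspose_apply, Matrix.of_apply, ht, hjk,
      Fintype.sum_prod_type, ite_mul, zero_mul, Finset.sum_ite_eq',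
      Finset.mem_univ, if_true, sub_left_inj, Matrix.one_apply, Prod.mk.injEq]
    by_cases hj : j = j'
    · simpa only [hj, if_true, true_and] using sum_omegaPow_mul_star d l l'
    · simp [hj]
end
end

section
/- Let d ≥ 1, ω = exp(2πi/d), and let t : (ZMod d)⁴ → ℂ be given by t(i,j,k,l) = d^{-1/2}·ω^{i·l} if j = i + k and 0 otherwise. Define the d²×d² matrix T3((j,k),(i,l)) := t(i,j,k,l). Then: (i) the entries of T3·T3* are (T3·T3*)((j,k),(j',k')) = 1 if j − k = j' − k' and 0 otherwise; (ii) the operator norm of T3 equals √d; and (iii) if d ≥ 2, T3 is not unitary. -/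
open Matrix MeasureTheory ProbabilityTheory
open scoped ComplexOrder BigOperators

noncomputable section

theorem omegaPow_mul_star (d : ℕ) [NeZero d] (x : ZMod d) :
    omegaPow d x * star (omegaPow d x) = 1 := by
  have hx : omegaPow d x = Complex.exp ((2 * Real.pi * x.val / d : ℝ) * Complex.I) := by
    rw [omegaPow]
    congr 1
    push_cast
    ring
  rw [Complex.star_def, Complex.mul_conj', hx, Complex.norm_exp_ofReal_mul_I]
  simp

open scoped Matrix.Norms.L2Operator in
theorem opNorm_eq_sqrt_of_mul_self_eq_smul {A : Type*} [Fintype A] [DecidableEq A]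
    (T : Matrix A A ℂ) (c : ℝ) (hc : 0 ≤ c) (hT : T ≠ 0)
    (h : (T * Tᴴ) * (T * Tᴴ) = (c : ℂ) • (T * Tᴴ)) : opNorm T = Real.sqrt c := by
  have hop : opNorm T = ‖T‖ := (Matrix.l2_opNorm_def T).symm
  have hM : ‖T * Tᴴ‖ = ‖T‖ * ‖T‖ := CStarRing.norm_self_mul_star
  have hsq : ‖T * Tᴴ‖ * ‖T * Tᴴ‖ = c * ‖T * Tᴴ‖ := by
    have hself : ‖(T * Tᴴ) * (T * Tᴴ)ᴴ‖ = ‖T * Tᴴ‖ * ‖T * Tᴴ‖ := CStarRing.norm_self_mul_star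
    rw [(Matrix.isHermitian_mul_conjTranspose_self T).eq, h, norm_smul, Complex.norm_real,
      Real.norm_of_nonneg hc] at hself
    exact hself.symm
  have hpos : 0 < ‖T‖ := norm_pos_iff.mpr hT
  have hMc : ‖T * Tᴴ‖ = c := mul_right_cancel₀ (by rw [hM]; positivity) hsq
  rw [hop, ← hMc, hM, Real.sqrt_mul_self hpos.le]

/-- for the VIP tensor `t(i,j,k,l) = d^{-1/2} ω^{il} [j = i + k]` and the matrix
`T3((j,k),(i,l)) = t(i,j,k,l)`: (i) `(T3 T3*)((j,k),(j',k')) = [j − k = j' − k']`;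
(ii) `‖T3‖∞ = √d`; (iii) if `d ≥ 2` then `T3` is not unitary. -/
theorem stmt18 (d : ℕ) [NeZero d]
    (t : ZMod d → ZMod d → ZMod d → ZMod d → ℂ)
    (ht : ∀ i j k l, t i j k l =
        if j = i + k then (Real.sqrt d : ℂ)⁻¹ * omegaPow d (i * l) else 0)
    (T3 : Matrix (ZMod d × ZMod d) (ZMod d × ZMod d) ℂ)
    (hT3 : T3 = Matrix.of fun p q : ZMod d × ZMod d => t q.1 p.1 p.2 q.2) :
    (∀ p p' : ZMod d × ZMod d,
        (T3 * T3ᴴ) p p' = if p.1 - p.2 = p'.1 - p'.2 then 1 else 0) ∧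
    opNorm T3 = Real.sqrt d ∧
    (2 ≤ d → ¬ IsUnitaryM T3) := by
  have hd : (d : ℂ) ≠ 0 := Nat.cast_ne_zero.mpr (NeZero.ne d)
  have hsqrt : (Real.sqrt d : ℂ) * (Real.sqrt d : ℂ) = d := by
    rw [← Complex.ofReal_mul, Real.mul_self_sqrt d.cast_nonneg, Complex.ofReal_natCast]
  have hgram : ∀ p p' : ZMod d × ZMod d,
      (T3 * T3ᴴ) p p' = if p.1 - p.2 = p'.1 - p'.2 then 1 else 0 := by
    rintro ⟨j, k⟩ ⟨j', k'⟩
    have hterm : ∀ i l : ZMod d, t i j k l * star (t i j' k' l) =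
        if j - k = i then (if j' - k' = i then (d : ℂ)⁻¹ else 0) else 0 := by
      intro i l
      simp only [ht, sub_eq_iff_eq_add]
      split_ifs
      · rw [star_mul', mul_mul_mul_comm, omegaPow_mul_star, mul_one, star_inv₀,
          Complex.star_def, Complex.conj_ofReal, ← mul_inv, hsqrt]
      all_goals simp
    simp only [Matrix.mul_apply, Matrix.conjTranspose_apply, hT3, Matrix.of_apply,
      Fintype.sum_prod_type, hterm]
    rw [Finset.sum_comm]
    simp [hd, eq_comm]
  have hsq : (T3 * T3ᴴ) * (T3 * T3ᴴ) = ((d : ℝ) : ℂ) • (T3 * T3ᴴ) := by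
    ext ⟨j, k⟩ ⟨j', k'⟩
    rw [Matrix.mul_apply, Matrix.smul_apply]
    simp only [hgram, Fintype.sum_prod_type_right]
    have hrow : ∀ y : ZMod d,
        ∑ x : ZMod d, ((if j - k = x - y then (1 : ℂ) else 0) *
          if x - y = j' - k' then 1 else 0) = if j - k = j' - k' then 1 else 0 := by
      intro y
      rw [Finset.sum_eq_single (j - k + y)]
      · simp
      · intro x _ hx
        rw [if_neg (fun h => hx (by rw [h, sub_add_cancel])), zero_mul]
      · simp
    rw [Finset.sum_congr rfl fun y _ => hrow y]
    simp
  have hne : T3 ≠ 0 := by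
    intro h
    have := hgram 0 0
    simp [h] at this
  refine ⟨hgram, opNorm_eq_sqrt_of_mul_self_eq_smul T3 d d.cast_nonneg hne hsq, ?_⟩
  rintro h2 ⟨hU, -⟩
  have : Fact (1 < d) := ⟨h2⟩
  have h01 := hgram (0, 0) (1, 1)
  simp [hU] at h01
end
end
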